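/- arXiv:2009.08964 — 7 statements merged into one kernel-verified Lean document; each statement's English description precedes it below -/
import Mathlib

section
/- If p > q > 0 are relatively prime integers, then V(p/q) = V(p/(p−q)). -/
/-- Hirzebruch–Jung continued fraction `[x_1, …, x_k]⁻`,
defined recursively by `[x_k]⁻ = x_k` and `[x_1,…,x_k]⁻ = x_1 − 1/[x_2,…,x_k]⁻`. -/
noncomputable def hj : List ℝ → ℝ
  | [] => 0
  | [x] => x
  | x :: y :: l => x - 1 / hj (y :: l)

/-- The predicate asserting that the Hirzebruch–Jung continued fraction of a
(nonempty) tuple is defined, i.e. no division by zero occurs in the recursion. -/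
noncomputable def hjDef : List ℝ → Prop
  | [] => False
  | [_] => True
  | _ :: y :: l => hjDef (y :: l) ∧ hj (y :: l) ≠ 0

/-- `IsHJExp l p q` says that `l = (a_1, …, a_k)` is the Hirzebruch–Jung continued
fraction expansion of `p/q`: it is nonempty, all entries are integers `≥ 2`,
and `[a_1, …, a_k]⁻ = p/q`. -/
def IsHJExp (l : List ℤ) (p q : ℤ) : Prop :=
  l ≠ [] ∧ (∀ x ∈ l, 2 ≤ x) ∧ hj (l.map Int.cast) = (p : ℝ) / (q : ℝ)

/-- `U([a_1,…,a_k]⁻) = Σ (a_i − 2)`. -/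
def Ulist (l : List ℤ) : ℤ := (l.map (· - 2)).sum

/-- `V([a_1,…,a_k]⁻) = Σ (a_i − 1)`. -/
def Vlist (l : List ℤ) : ℤ := (l.map (· - 1)).sum

theorem hj_cons (x : ℝ) {l : List ℝ} (hl : l ≠ []) : hj (x :: l) = x - 1 / hj l := by
  cases l with
  | nil => exact absurd rfl hl
  | cons y l => rfl

/-- A Hirzebruch–Jung continued fraction with entries at least `2` is greater than `1`. -/
theorem one_lt_hj (l : List ℤ) (hl : l ≠ []) (h : ∀ x ∈ l, 2 ≤ x) :
    1 < hj (l.map Int.cast) := by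
  induction l with
  | nil => exact absurd rfl hl
  | cons x l ih =>
    have hx : (2 : ℝ) ≤ x := by exact_mod_cast h x (by simp)
    rcases eq_or_ne l [] with rfl | hl'
    · simp only [List.map_cons, List.map_nil, hj]
      linarith
    · have h1 := ih hl' fun y hy => h y (by simp [hy])
      have h2 : 1 / hj (l.map Int.cast) < 1 := by
        rw [div_lt_one (by linarith)]
        exact h1
      rw [List.map_cons, hj_cons _ (by simpa using hl')]
      linarith

/-- The shape of an expansion according to the position of its value relative to `2`. -/
theorem hj_shape (l : List ℤ) (hl : l ≠ []) (h : ∀ x ∈ l, 2 ≤ x) :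
    (hj (l.map Int.cast) = 2 ∧ l = [2]) ∨
    (hj (l.map Int.cast) < 2 ∧ ∃ t, t ≠ [] ∧ l = 2 :: t) ∨
    (2 < hj (l.map Int.cast) ∧ ∃ c t, 3 ≤ c ∧ l = c :: t) := by
  obtain ⟨x, l, rfl⟩ := List.exists_cons_of_ne_nil hl
  rcases (h x (by simp)).eq_or_lt with rfl | hx
  · rcases eq_or_ne l [] with rfl | hl'
    · exact Or.inl ⟨by simp [hj], rfl⟩
    · refine Or.inr (Or.inl ⟨?_, l, hl', rfl⟩)
      have h1 := one_lt_hj l hl' fun y hy => h y (by simp [hy])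
      rw [List.map_cons, hj_cons _ (by simpa using hl')]
      have h2 : 0 < 1 / hj (l.map Int.cast) := by positivity
      push_cast
      linarith
  · refine Or.inr (Or.inr ⟨?_, x, l, hx, rfl⟩)
    have hx' : (3 : ℝ) ≤ x := by exact_mod_cast hx
    rcases eq_or_ne l [] with rfl | hl'
    · simp only [List.map_cons, List.map_nil, hj]
      linarith
    · have h1 := one_lt_hj l hl' fun y hy => h y (by simp [hy])
      have h2 : 1 / hj (l.map Int.cast) < 1 := by
        rw [div_lt_one (by linarith)]
        exact h1
      rw [List.map_cons, hj_cons _ (by simpa using hl')]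
      linarith

theorem hj_sub_one_cons (c : ℤ) (t : List ℤ) :
    hj (((c - 1) :: t).map Int.cast) = hj ((c :: t).map Int.cast) - 1 := by
  cases t with
  | nil => simp [hj]
  | cons y t =>
    simp only [List.map_cons, hj]
    push_cast
    ring

/-- Removing a leading `2` on one side corresponds to lowering the first entry by one on the
other side. -/
theorem hj_mul_eq_add_reduce (c : ℤ) (t s : List ℤ) (ht : t ≠ []) (ht₂ : ∀ x ∈ t, 2 ≤ x)
    (h : hj ((2 :: t).map Int.cast) * hj ((c :: s).map Int.cast) =
      hj ((2 :: t).map Int.cast) + hj ((c :: s).map Int.cast)) :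
    hj (t.map Int.cast) * hj (((c - 1) :: s).map Int.cast) =
      hj (t.map Int.cast) + hj (((c - 1) :: s).map Int.cast) := by
  have h1 := one_lt_hj t ht ht₂
  rw [hj_sub_one_cons]
  rw [List.map_cons, hj_cons _ (by simpa using ht)] at h
  push_cast at h
  have h0 : hj (t.map Int.cast) ≠ 0 := by positivity
  field_simp at h
  linarith

/-- Expansions of reals `X`, `Y` with `1 / X + 1 / Y = 1` have the same `V`. -/
theorem Vlist_eq_of_mul_eq_add (n : ℕ) (a b : List ℤ) (hn : a.length + b.length ≤ n)
    (ha : a ≠ []) (hb : b ≠ []) (ha₂ : ∀ x ∈ a, 2 ≤ x) (hb₂ : ∀ x ∈ b, 2 ≤ x)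
    (h : hj (a.map Int.cast) * hj (b.map Int.cast) =
      hj (a.map Int.cast) + hj (b.map Int.cast)) :
    Vlist a = Vlist b := by
  induction n generalizing a b with
  | zero => exact absurd (List.eq_nil_of_length_eq_zero (by omega)) ha
  | succ n ih =>
    have step : ∀ (c : ℤ) (t s : List ℤ), 3 ≤ c → t ≠ [] →
        (2 :: t).length + (c :: s).length ≤ n + 1 →
        (∀ x ∈ 2 :: t, 2 ≤ x) → (∀ x ∈ c :: s, 2 ≤ x) →
        hj ((2 :: t).map Int.cast) * hj ((c :: s).map Int.cast) =
          hj ((2 :: t).map Int.cast) + hj ((c :: s).map Int.cast) →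
        Vlist (2 :: t) = Vlist (c :: s) := by
      intro c t s hc ht hlen ht₂ hs₂ hts
      have ht₂' : ∀ x ∈ t, 2 ≤ x := fun x hx => ht₂ x (by simp [hx])
      have key := ih t ((c - 1) :: s) (by simp at hlen ⊢; omega) ht (by simp) ht₂'
        (by
          intro x hx
          rcases List.mem_cons.1 hx with rfl | hx
          · omega
          · exact hs₂ x (by simp [hx]))
        (hj_mul_eq_add_reduce c t s ht ht₂' hts)
      simp only [Vlist, List.map_cons, List.sum_cons] at key ⊢
      omega
    rcases hj_shape a ha ha₂ with ⟨hX, ha'⟩ | ⟨hX, t, ht, ha'⟩ | ⟨hX, c, s, hc, ha'⟩ <;>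
    rcases hj_shape b hb hb₂ with ⟨hY, hb'⟩ | ⟨hY, t', ht', hb'⟩ | ⟨hY, c', s', hc', hb'⟩
    case inr.inl.inr.inr =>
      subst ha' hb'
      exact step c' t s' hc' ht hn ha₂ hb₂ h
    case inr.inr.inr.inl =>
      subst ha' hb'
      exact (step c t' s hc ht' (by omega) hb₂ ha₂ (by linarith)).symm
    case inl.inl => rw [ha', hb']
    all_goals
      exfalso
      have hX₁ := one_lt_hj a ha ha₂
      have hY₁ := one_lt_hj b hb hb₂
      nlinarith

/-- If `p > q > 0` are relatively prime integers, then `V(p/q) = V(p/(p−q))`. -/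
theorem stmt_6 (p q : ℤ) (hq : 0 < q) (hpq : q < p) (hco : IsCoprime p q)
    (a b : List ℤ) (ha : IsHJExp a p q) (hb : IsHJExp b p (p - q)) :
    Vlist a = Vlist b := by
  have hq' : (0 : ℝ) < q := by exact_mod_cast hq
  have hpq' : (0 : ℝ) < p - q := by exact_mod_cast sub_pos.2 hpq
  have hp' : (0 : ℝ) < p := by linarith
  obtain ⟨ha₀, ha₂, hav⟩ := ha
  obtain ⟨hb₀, hb₂, hbv⟩ := hb
  refine Vlist_eq_of_mul_eq_add _ a b le_rfl ha₀ hb₀ ha₂ hb₂ ?_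
  rw [hav, hbv]
  push_cast
  field_simp
  ring
end

section
/- If p > q > 0 are relatively prime integers, then len(p/q) = U(p/(p−q)) + 1. -/
theorem hj_map_cons_cons (x y : ℤ) (l : List ℤ) :
    hj ((x :: y :: l).map Int.cast) = x - 1 / hj ((y :: l).map Int.cast) := rfl

theorem hj_map_singleton (x : ℤ) : hj ([x].map Int.cast) = x := rfl

/-- Lowering the leading entry by one lowers the value by one. -/
theorem hj_map_sub_one_cons (x : ℤ) (l : List ℤ) :
    hj (((x - 1) :: l).map Int.cast) = hj ((x :: l).map Int.cast) - 1 := by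
  cases l with
  | nil => simp [hj]
  | cons y l =>
    rw [hj_map_cons_cons, hj_map_cons_cons]
    push_cast
    ring

/-- If the entries after the first are at least `2`, the value exceeds the first entry
minus one. -/
theorem sub_one_lt_hj_map_cons (l : List ℤ) (x : ℤ) (hl : ∀ z ∈ l, 2 ≤ z) :
    (x : ℝ) - 1 < hj ((x :: l).map Int.cast) := by
  induction l generalizing x with
  | nil => simp [hj]
  | cons y l ih =>
    have hy : (2 : ℝ) ≤ y := by exact_mod_cast hl y (by simp)
    have h := ih y fun z hz => hl z (by simp [hz])
    have h1 : 1 < hj ((y :: l).map Int.cast) := by linarith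
    have h2 := (div_lt_one (by linarith)).2 h1
    rw [hj_map_cons_cons]
    linarith

theorem one_lt_hj_map_cons (l : List ℤ) (x : ℤ) (hl : ∀ z ∈ x :: l, 2 ≤ z) :
    1 < hj ((x :: l).map Int.cast) := by
  have hx : (2 : ℝ) ≤ x := by exact_mod_cast hl x (by simp)
  have := sub_one_lt_hj_map_cons l x fun z hz => hl z (by simp [hz])
  linarith

theorem hj_map_cons_cons_lt (x y : ℤ) (l : List ℤ) (hl : ∀ z ∈ y :: l, 2 ≤ z) :
    hj ((x :: y :: l).map Int.cast) < x := by
  have h := one_lt_hj_map_cons l y hl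
  have : 0 < 1 / hj ((y :: l).map Int.cast) := by positivity
  rw [hj_map_cons_cons]
  linarith

theorem hj_map_cons_le (x : ℤ) (l : List ℤ) (hl : ∀ z ∈ l, 2 ≤ z) :
    hj ((x :: l).map Int.cast) ≤ x := by
  cases l with
  | nil => simp [hj]
  | cons y l => exact (hj_map_cons_cons_lt x y l hl).le

/-- The only expansion of `2` with entries at least `2` is `[2]`. -/
theorem eq_of_hj_map_cons_eq_two (x : ℤ) (l : List ℤ) (hl : ∀ z ∈ l, 2 ≤ z)
    (h : hj ((x :: l).map Int.cast) = 2) : x = 2 ∧ l = [] := by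
  cases l with
  | nil =>
    rw [hj_map_singleton] at h
    exact ⟨by exact_mod_cast h, rfl⟩
  | cons y l =>
    have h1 := sub_one_lt_hj_map_cons (y :: l) x hl
    have h2 := hj_map_cons_cons_lt x y l hl
    rw [h] at h1 h2
    have h3 : x < 3 := by
      have : (x : ℝ) < 3 := by linarith
      exact_mod_cast this
    have h4 : 2 < x := by exact_mod_cast h2
    omega

/-- If `1/x + 1/y = 1` and `x = [2, c, …]⁻`, then removing the leading `2` from the expansion of
`x` and lowering the leading entry of that of `y` gives a pair with the same relation. -/
theorem hj_dual_step (c d : ℤ) (a b : List ℤ) (ha : ∀ z ∈ c :: a, 2 ≤ z) (hb : ∀ z ∈ b, 2 ≤ z)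
    (h : hj ((2 :: c :: a).map Int.cast) + hj ((d :: b).map Int.cast) =
      hj ((2 :: c :: a).map Int.cast) * hj ((d :: b).map Int.cast)) :
    3 ≤ d ∧ hj ((c :: a).map Int.cast) + hj (((d - 1) :: b).map Int.cast) =
      hj ((c :: a).map Int.cast) * hj (((d - 1) :: b).map Int.cast) := by
  have hx := one_lt_hj_map_cons a c ha
  have hd := hj_map_cons_le d b hb
  rw [hj_map_sub_one_cons]
  rw [hj_map_cons_cons] at h
  generalize hj ((c :: a).map Int.cast) = x at *
  generalize hj ((d :: b).map Int.cast) = y at *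
  have hx0 : x ≠ 0 := by linarith
  push_cast at h
  field_simp at h
  have hy : 2 < y := by nlinarith
  refine ⟨?_, by linarith⟩
  have : (2 : ℝ) < d := by linarith
  have : 2 < d := by exact_mod_cast this
  omega

theorem Ulist_cons (x : ℤ) (l : List ℤ) : Ulist (x :: l) = x - 2 + Ulist l := by
  simp [Ulist]

/-- Riemenschneider duality between lengths and `U` for expansions of `x` and `y` with
`1/x + 1/y = 1`, that is, `x + y = x * y`. -/
theorem length_eq_Ulist_of_hj_dual (n : ℕ) : ∀ (c d : ℤ) (a b : List ℤ),
    a.length + b.length = n → (∀ z ∈ c :: a, 2 ≤ z) → (∀ z ∈ d :: b, 2 ≤ z) →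
    hj ((c :: a).map Int.cast) + hj ((d :: b).map Int.cast) =
      hj ((c :: a).map Int.cast) * hj ((d :: b).map Int.cast) →
    ((c :: a).length : ℤ) = Ulist (d :: b) + 1 ∧
      ((d :: b).length : ℤ) = Ulist (c :: a) + 1 := by
  induction n with
  | zero =>
    intro c d a b hn ha hb h
    obtain rfl : a = [] := List.length_eq_zero_iff.1 (by omega)
    obtain rfl : b = [] := List.length_eq_zero_iff.1 (by omega)
    simp only [hj_map_singleton] at h
    have h : c + d = c * d := by exact_mod_cast h
    have hc : 2 ≤ c := ha c (by simp)
    have hd : 2 ≤ d := hb d (by simp)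
    obtain rfl : c = 2 := by nlinarith
    obtain rfl : d = 2 := by omega
    simp [Ulist]
  | succ n ih =>
    have key : ∀ (d : ℤ) (a b : List ℤ), a.length + b.length = n + 1 →
        (∀ z ∈ a, 2 ≤ z) → (∀ z ∈ d :: b, 2 ≤ z) →
        hj ((2 :: a).map Int.cast) + hj ((d :: b).map Int.cast) =
          hj ((2 :: a).map Int.cast) * hj ((d :: b).map Int.cast) →
        ((2 :: a).length : ℤ) = Ulist (d :: b) + 1 ∧
          ((d :: b).length : ℤ) = Ulist (2 :: a) + 1 := by
      intro d a b hn ha hb h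
      have hb' : ∀ z ∈ b, 2 ≤ z := fun z hz => hb z (by simp [hz])
      cases a with
      | nil =>
        rw [hj_map_singleton] at h
        push_cast at h
        obtain ⟨rfl, rfl⟩ := eq_of_hj_map_cons_eq_two d b hb' (by linarith)
        simp at hn
      | cons c a =>
        obtain ⟨hd, h'⟩ := hj_dual_step c d a b ha hb' h
        obtain ⟨h1, h2⟩ := ih c (d - 1) a b (by simp at hn; omega) ha
          (by
            intro z hz
            rcases List.mem_cons.1 hz with rfl | hz
            · omega
            · exact hb' z hz) h'
        simp only [Ulist_cons, List.length_cons] at *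
        push_cast at *
        constructor <;> linarith
    intro c d a b hn ha hb h
    have ha' : ∀ z ∈ a, 2 ≤ z := fun z hz => ha z (by simp [hz])
    have hb' : ∀ z ∈ b, 2 ≤ z := fun z hz => hb z (by simp [hz])
    have hc : 2 ≤ c := ha c (by simp)
    have hd : 2 ≤ d := hb d (by simp)
    rcases hc.eq_or_lt with rfl | hc
    · exact key d a b hn ha' hb h
    rcases hd.eq_or_lt with rfl | hd
    · exact (key c b a (by omega) hb' ha (by linarith)).symm
    have h1 := sub_one_lt_hj_map_cons a c ha'
    have h2 := sub_one_lt_hj_map_cons b d hb'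
    have hc3 : (3 : ℝ) ≤ c := by exact_mod_cast hc
    have hd3 : (3 : ℝ) ≤ d := by exact_mod_cast hd
    nlinarith

/-- If `p > q > 0` are relatively prime integers, then `len(p/q) = U(p/(p−q)) + 1`. -/
theorem stmt_7 (p q : ℤ) (hq : 0 < q) (hpq : q < p) (hco : IsCoprime p q)
    (a b : List ℤ) (ha : IsHJExp a p q) (hb : IsHJExp b p (p - q)) :
    (a.length : ℤ) = Ulist b + 1 := by
  obtain ⟨ha0, ha2, hae⟩ := ha
  obtain ⟨hb0, hb2, hbe⟩ := hb
  obtain ⟨c, a, rfl⟩ := List.exists_cons_of_ne_nil ha0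
  obtain ⟨d, b, rfl⟩ := List.exists_cons_of_ne_nil hb0
  refine (length_eq_Ulist_of_hj_dual _ c d a b rfl ha2 hb2 ?_).1
  have hq' : (q : ℝ) ≠ 0 := by exact_mod_cast hq.ne'
  have hpq' : (p : ℝ) - q ≠ 0 := sub_ne_zero.2 (by exact_mod_cast hpq.ne')
  rw [hae, hbe]
  push_cast
  field_simp
  ring
end

section
/- Let p > q > 0 be relatively prime integers. If V(p/q) = L, then p ≤ F_{L+2}. -/
/-- Fibonacci bounds on `p`, `q` and `p - q` persist when `p / q` is replaced by `p / q + k`,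
that is, when the first entry of the continued fraction is increased by `k`. -/
theorem le_fib_of_increase_first_entry (p q : ℤ) (M : ℕ) (hp : p ≤ Nat.fib (M + 2))
    (hq : q ≤ Nat.fib (M + 1)) (hr : p - q ≤ Nat.fib (M + 1)) (k : ℕ) :
    p + k * q ≤ Nat.fib (M + k + 2) ∧ q ≤ Nat.fib (M + k + 1) ∧
      p + k * q - q ≤ Nat.fib (M + k + 1) := by
  induction k with
  | zero => simpa using ⟨hp, hq, by linarith⟩
  | succ k ih =>
    obtain ⟨h1, h2, h3⟩ := ih
    have hf : Nat.fib (M + k + 3) = Nat.fib (M + k + 1) + Nat.fib (M + k + 2) := Nat.fib_add_two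
    have hm : Nat.fib (M + k + 1) ≤ Nat.fib (M + k + 2) := Nat.fib_le_fib_succ
    zify at hf hm
    simp only [← add_assoc, show M + k + 1 + 2 = M + k + 3 by rfl,
      show M + k + 1 + 1 = M + k + 2 by rfl]
    push_cast
    exact ⟨by linarith, by linarith, by linarith⟩

/-- A Hirzebruch–Jung continued fraction with entries `≥ 2` equals `n / d` with `n > d > 0`
coprime, where `n`, `d` and `n - d` are bounded by Fibonacci numbers. -/
theorem exists_hj_eq_div_le_fib (x : ℤ) (l : List ℤ) (h : ∀ y ∈ x :: l, 2 ≤ y) :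
    ∃ (n d : ℤ) (M : ℕ), (M : ℤ) = Vlist (x :: l) ∧ 0 < d ∧ d < n ∧ IsCoprime n d ∧
      hj ((x :: l).map Int.cast) = (n : ℝ) / d ∧
      n ≤ Nat.fib (M + 2) ∧ d ≤ Nat.fib (M + 1) ∧ n - d ≤ Nat.fib (M + 1) := by
  induction l generalizing x with
  | nil =>
    have hx : 2 ≤ x := h x (by simp)
    obtain ⟨k, hk⟩ := Int.eq_ofNat_of_zero_le (sub_nonneg.2 hx)
    obtain rfl : x = k + 2 := by linarith
    obtain ⟨h1, h2, h3⟩ := le_fib_of_increase_first_entry 2 1 1 (by decide) (by decide)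
      (by decide) k
    refine ⟨k + 2, 1, 1 + k, ?_, by norm_num, by linarith, isCoprime_one_right, ?_, by linarith,
      h2, by linarith⟩
    · simp [Vlist]; ring
    · simp [hj]
  | cons y l ih =>
    obtain ⟨n, d, M, hM, hd, hdn, hc, he, h1, h2, h3⟩ :=
      ih y fun z hz => h z (List.mem_cons_of_mem _ hz)
    have hx : 2 ≤ x := h x (by simp)
    obtain ⟨k, hk⟩ := Int.eq_ofNat_of_zero_le (sub_nonneg.2 hx)
    obtain rfl : x = k + 2 := by linarith
    have hf : Nat.fib (M + 3) = Nat.fib (M + 1) + Nat.fib (M + 2) := Nat.fib_add_two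
    have hm : Nat.fib (M + 1) ≤ Nat.fib (M + 2) := Nat.fib_le_fib_succ
    zify at hf hm
    obtain ⟨g1, g2, g3⟩ := le_fib_of_increase_first_entry (2 * n - d) n (M + 1)
      (by rw [show M + 1 + 2 = M + 3 by rfl]; linarith) h1
      (by rw [show M + 1 + 1 = M + 2 by rfl]; linarith) k
    have hkn : 0 ≤ (k : ℤ) * n := by have : 0 < n := hd.trans hdn; positivity
    refine ⟨(k + 2) * n - d, n, M + 1 + k, ?_, hd.trans hdn, by linarith, ?_, ?_, by linarith,
      g2, by linarith⟩
    · simp only [Vlist, List.map_cons, List.sum_cons] at hM ⊢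
      push_cast
      linarith
    · obtain ⟨a, b, hab⟩ := hc
      exact ⟨-b, a + b * (k + 2), by linear_combination hab⟩
    · have hn : (n : ℝ) ≠ 0 := by exact_mod_cast (hd.trans hdn).ne'
      have hd' : (d : ℝ) ≠ 0 := by exact_mod_cast hd.ne'
      simp only [List.map_cons, hj] at he ⊢
      rw [he]
      push_cast
      field_simp

/-- Let `p > q > 0` be relatively prime integers. If `V(p/q) = L`, then
`p ≤ F_{L+2}`, where `F` is the Fibonacci sequence with `F_1 = F_2 = 1`. -/
theorem stmt_10 (p q : ℤ) (hq : 0 < q) (hpq : q < p) (hco : IsCoprime p q)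
    (a : List ℤ) (ha : IsHJExp a p q) (L : ℕ) (hL : (L : ℤ) = Vlist a) :
    p ≤ (Nat.fib (L + 2) : ℤ) := by
  obtain ⟨hne, h2, he⟩ := ha
  obtain ⟨x, l, rfl⟩ := List.exists_cons_of_ne_nil hne
  obtain ⟨n, d, M, hM, hd, hdn, hc, hn, h1, -, -⟩ := exists_hj_eq_div_le_fib x l h2
  obtain rfl : L = M := by exact_mod_cast hL.trans hM.symm
  have hq' : (q : ℝ) ≠ 0 := by exact_mod_cast hq.ne'
  have hd' : (d : ℝ) ≠ 0 := by exact_mod_cast hd.ne'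
  rw [hn, div_eq_div_iff hd' hq'] at he
  have hmul : n * q = p * d := by exact_mod_cast he
  have hdvd : p ∣ n := hco.dvd_of_dvd_mul_right (hmul ▸ dvd_mul_right p d)
  exact (Int.le_of_dvd (hd.trans hdn) hdvd).trans h1
end

section
/- Let n = (n_1,…,n_k) be a tuple of non-negative integers with n_j = 1 for some 1 ≤ j ≤ k, and let n′ be the blow down of n at j. Then n is admissible if and only if n′ is admissible. -/
/-- The tuple `(a_i, a_{i+1}, …, a_j)` as a list of integers. -/
def seg (a : ℕ → ℤ) (i j : ℕ) : List ℤ :=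
  (List.range (j + 1 - i)).map fun t => a (i + t)

/-- The tuple `(a_i, a_{i+1}, …, a_j)` as a list of real numbers. -/
noncomputable def segR (a : ℕ → ℤ) (i j : ℕ) : List ℝ :=
  (seg a i j).map Int.cast

/-- The tridiagonal matrix `M(x)` (with real entries) with diagonal entries
`x_1, …, x_k` and all sub- and super-diagonal entries equal to `−1`. -/
noncomputable def MmatR (l : List ℤ) : Matrix (Fin l.length) (Fin l.length) ℝ :=
  Matrix.of fun i j =>
    if (i : ℕ) = (j : ℕ) then (l.get i : ℝ)
    else if (i : ℕ) + 1 = (j : ℕ) ∨ (j : ℕ) + 1 = (i : ℕ) then -1 else 0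

/-- A tuple of (non-negative) integers is admissible if `M(n)` is positive
semi-definite of rank at least `k − 1`. -/
def Admissible (l : List ℤ) : Prop :=
  (MmatR l).PosSemidef ∧ l.length - 1 ≤ (MmatR l).rank

/-- The blow down of the tuple `(n_1, …, n_k)` at an index `j` with `n_j = 1`:
it is `(n_1,…,n_{j−1}−1, n_{j+1}−1,…,n_k)` if `1 < j < k`,
`(n_1,…,n_{k−2}, n_{k−1}−1)` if `j = k`, and `(n_2−1, n_3,…,n_k)` if `j = 1`;
the resulting tuple has length `k − 1` and its `i`-th entry (`1 ≤ i ≤ k−1`)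
is given by the formula below. -/
def blowDown (n : ℕ → ℤ) (j : ℕ) : ℕ → ℤ := fun i =>
  if i + 1 < j then n i
  else if i + 1 = j then n (j - 1) - 1
  else if i = j then n (j + 1) - 1
  else n (i + 1)

namespace Matrix

variable {m n K : Type*} [Fintype m] [Fintype n] [DecidableEq n]

/-- The kernel of a block matrix with identity lower right block is isomorphic to the kernel of
its Schur complement. -/
def kerFromBlocksOneEquiv [CommRing K] (A : Matrix m m K) (B : Matrix m n K) (C : Matrix n m K) :
    LinearMap.ker (fromBlocks A B C 1).mulVecLin ≃ₗ[K]
      LinearMap.ker (A - B * C).mulVecLin where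
  toFun x := ⟨x.1 ∘ Sum.inl, by
    have hx := x.2
    rw [LinearMap.mem_ker, mulVecLin_apply, fromBlocks_mulVec, one_mulVec] at hx
    have h₁ : A *ᵥ (x.1 ∘ Sum.inl) + B *ᵥ (x.1 ∘ Sum.inr) = 0 :=
      funext fun i => congrFun hx (Sum.inl i)
    have h₂ : C *ᵥ (x.1 ∘ Sum.inl) + x.1 ∘ Sum.inr = 0 :=
      funext fun i => congrFun hx (Sum.inr i)
    rw [LinearMap.mem_ker, mulVecLin_apply, sub_mulVec, ← mulVec_mulVec,
      eq_neg_of_add_eq_zero_left h₂, mulVec_neg, sub_neg_eq_add, h₁]⟩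
  invFun y := ⟨Sum.elim y.1 (-(C *ᵥ y.1)), by
    have hy := y.2
    rw [LinearMap.mem_ker, mulVecLin_apply, sub_mulVec, ← mulVec_mulVec] at hy
    rw [LinearMap.mem_ker, mulVecLin_apply, fromBlocks_mulVec, one_mulVec, Sum.elim_comp_inl,
      Sum.elim_comp_inr, mulVec_neg, ← sub_eq_add_neg, hy, add_neg_cancel, Sum.elim_zero_zero]⟩
  map_add' _ _ := rfl
  map_smul' _ _ := rfl
  left_inv x := by
    have hx := x.2
    rw [LinearMap.mem_ker, mulVecLin_apply, fromBlocks_mulVec, one_mulVec] at hx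
    have h₂ : C *ᵥ (x.1 ∘ Sum.inl) + x.1 ∘ Sum.inr = 0 :=
      funext fun i => congrFun hx (Sum.inr i)
    ext i
    rcases i with i | i
    · rfl
    · exact (congrFun (eq_neg_of_add_eq_zero_right h₂) i).symm
  right_inv _ := rfl

theorem rank_fromBlocks_one [Field K] (A : Matrix m m K) (B : Matrix m n K) (C : Matrix n m K) :
    (fromBlocks A B C 1).rank = (A - B * C).rank + Fintype.card n := by
  have h₁ := LinearMap.finrank_range_add_finrank_ker (fromBlocks A B C 1).mulVecLin
  have h₂ := LinearMap.finrank_range_add_finrank_ker (A - B * C).mulVecLin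
  rw [(kerFromBlocksOneEquiv A B C).finrank_eq, Module.finrank_fintype_fun_eq_card,
    Fintype.card_sum] at h₁
  rw [Module.finrank_fintype_fun_eq_card] at h₂
  rw [rank, rank]
  omega

end Matrix

/-- The tridiagonal matrix with diagonal entries `a_1, …, a_k`, indexed by `Fin k`. -/
noncomputable def tridiag (a : ℕ → ℤ) (k : ℕ) : Matrix (Fin k) (Fin k) ℝ :=
  Matrix.of fun i j =>
    if (i : ℕ) = (j : ℕ) then (a (1 + i) : ℝ)
    else if (i : ℕ) + 1 = (j : ℕ) ∨ (j : ℕ) + 1 = (i : ℕ) then -1 else 0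

theorem length_seg_one (a : ℕ → ℤ) (k : ℕ) : (seg a 1 k).length = k := by
  simp [seg]

theorem admissible_seg_one_iff (a : ℕ → ℤ) (k : ℕ) :
    Admissible (seg a 1 k) ↔ (tridiag a k).PosSemidef ∧ k - 1 ≤ (tridiag a k).rank := by
  have hget (i : Fin (seg a 1 k).length) : (seg a 1 k).get i = a (1 + i) := by
    rw [List.get_eq_getElem]
    simp only [seg, List.getElem_map, List.getElem_range]
  have h : MmatR (seg a 1 k) = (tridiag a k).submatrix (finCongr (length_seg_one a k))
      (finCongr (length_seg_one a k)) := by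
    ext i j
    simp only [Matrix.submatrix_apply, tridiag, MmatR, Matrix.of_apply, hget]
    rfl
  rw [Admissible, h, Matrix.posSemidef_submatrix_equiv, Matrix.rank_submatrix, length_seg_one]

/-- The column of `tridiag n (m + 1)` at index `p`, with its `p`-th entry removed. -/
noncomputable def tridiagCol {m : ℕ} (p : Fin (m + 1)) : Matrix (Fin m) Unit ℝ :=
  Matrix.of fun i _ => if (i : ℕ) + 1 = p ∨ (i : ℕ) = p then -1 else 0

/-- The equivalence moving the index `p` to the second summand. -/
def sumUnitEquivFin {m : ℕ} (p : Fin (m + 1)) : Fin m ⊕ Unit ≃ Fin (m + 1) :=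
  (Equiv.optionEquivSumPUnit (Fin m)).symm.trans (finSuccEquiv' p).symm

theorem sumUnitEquivFin_inl {m : ℕ} (p : Fin (m + 1)) (i : Fin m) :
    sumUnitEquivFin p (Sum.inl i) = p.succAbove i := by
  simp [sumUnitEquivFin]

theorem sumUnitEquivFin_inr {m : ℕ} (p : Fin (m + 1)) (u : Unit) :
    sumUnitEquivFin p (Sum.inr u) = p := by
  simp [sumUnitEquivFin]

theorem Fin.val_succAbove_eq {m : ℕ} (p : Fin (m + 1)) (i : Fin m) :
    (p.succAbove i : ℕ) = if (i : ℕ) < p then (i : ℕ) else i + 1 := by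
  simp only [Fin.succAbove, Fin.lt_def, Fin.val_castSucc]
  split_ifs <;> simp

theorem tridiag_submatrix_eq_fromBlocks (n : ℕ → ℤ) {m : ℕ} (p : Fin (m + 1))
    (hp : n (p + 1) = 1) :
    (tridiag n (m + 1)).submatrix (sumUnitEquivFin p) (sumUnitEquivFin p) =
      Matrix.fromBlocks
        (tridiag (blowDown n (p + 1)) m + tridiagCol p * (tridiagCol p).conjTranspose)
        (tridiagCol p) (tridiagCol p).conjTranspose 1 := by
  ext (i | i) (j | j)
  · simp only [Matrix.submatrix_apply, sumUnitEquivFin_inl, Matrix.fromBlocks_apply₁₁,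
      Matrix.add_apply, Matrix.mul_apply, Matrix.conjTranspose_apply, tridiag, tridiagCol,
      Matrix.of_apply, Fin.val_succAbove_eq, blowDown, Finset.univ_unique, Finset.sum_singleton,
      star_trivial]
    obtain ⟨i, hi⟩ := i
    obtain ⟨j, hj⟩ := j
    obtain ⟨p, hpm⟩ := p
    dsimp only at *
    by_cases hij : i = j
    · subst hij
      rcases lt_trichotomy (i + 1) p with h | h | h
      · grind
      · subst h
        grind
      · rcases eq_or_ne i p with h' | h'
        · subst h'
          grind
        · grind
    · grind
  · simp only [Matrix.submatrix_apply, sumUnitEquivFin_inl, sumUnitEquivFin_inr,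
      Matrix.fromBlocks_apply₁₂, tridiag, tridiagCol, Matrix.of_apply, Fin.val_succAbove_eq]
    grind
  · simp only [Matrix.submatrix_apply, sumUnitEquivFin_inl, sumUnitEquivFin_inr,
      Matrix.fromBlocks_apply₂₁, tridiag, tridiagCol, Matrix.of_apply, Fin.val_succAbove_eq,
      Matrix.conjTranspose_apply, star_trivial]
    grind
  · simp [sumUnitEquivFin_inr, tridiag, add_comm 1, hp]

/-- Let `n = (n_1,…,n_k)` be a tuple of non-negative integers with `n_j = 1`
for some `1 ≤ j ≤ k`, and let `n′` be the blow down of `n` at `j`. Then `n` is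
admissible if and only if `n′` is admissible. -/
theorem stmt_14 (n : ℕ → ℤ) (k j : ℕ) (h1 : 1 ≤ j) (hjk : j ≤ k)
    (hnn : ∀ i, 1 ≤ i → i ≤ k → 0 ≤ n i) (hj1 : n j = 1) :
    Admissible (seg n 1 k) ↔ Admissible (seg (blowDown n j) 1 (k - 1)) := by
  obtain ⟨m, rfl⟩ : ∃ m, k = m + 1 := ⟨k - 1, by omega⟩
  obtain ⟨q, rfl⟩ : ∃ q, j = q + 1 := ⟨j - 1, by omega⟩
  let p : Fin (m + 1) := ⟨q, by omega⟩
  have h := tridiag_submatrix_eq_fromBlocks n p hj1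
  have hpsd : (tridiag n (m + 1)).PosSemidef ↔ (tridiag (blowDown n (q + 1)) m).PosSemidef := by
    let : Invertible (1 : Matrix Unit Unit ℝ) := invertibleOne
    rw [← Matrix.posSemidef_submatrix_equiv (sumUnitEquivFin p), h,
      Matrix.PosDef.fromBlocks₂₂ _ _ Matrix.PosDef.one, inv_one, Matrix.mul_one,
      add_sub_cancel_right]
  have hrank : (tridiag n (m + 1)).rank = (tridiag (blowDown n (q + 1)) m).rank + 1 := by
    rw [← Matrix.rank_submatrix _ (sumUnitEquivFin p) (sumUnitEquivFin p), h,
      Matrix.rank_fromBlocks_one, add_sub_cancel_right, Fintype.card_unit]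
  rw [admissible_seg_one_iff, admissible_seg_one_iff, Nat.add_sub_cancel, hpsd, hrank,
    Nat.sub_le_iff_le_add]
end

section
/- Let n = (n_1,…,n_k) be an admissible tuple such that the Hirzebruch–Jung continued fraction [n_1,…,n_k]⁻ is defined and equals α/β, where α > 1 and β > 0 are relatively prime integers. Let β* be the unique integer with 1 ≤ β* < α and β* ≡ β (mod α). Then Σ_{i=1}^k (n_i − 2) ≥ U(α/β*). Moreover, equality implies n_i ≥ 2 for all i with 1 < i < k. -/
/-- The pair of continuants `(K(x_1, …, x_k), K(x_2, …, x_k))` of a tuple of integers. -/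
def continuants : List ℤ → ℤ × ℤ
  | [] => (1, 0)
  | x :: l => (x * (continuants l).1 - (continuants l).2, (continuants l).1)

/-- All suffixes of the tuple have positive continuant. -/
def SuffixPos : List ℤ → Prop
  | [] => True
  | x :: l => 0 < (continuants (x :: l)).1 ∧ SuffixPos l

theorem isCoprime_continuants (l : List ℤ) :
    IsCoprime (continuants l).1 (continuants l).2 := by
  induction l with
  | nil => exact isCoprime_one_left
  | cons x l ih =>
    obtain ⟨a, b, h⟩ := ih
    exact ⟨-b, a + b * x, by simp only [continuants]; linear_combination h⟩

theorem SuffixPos.fst_pos {l : List ℤ} (h : SuffixPos l) : 0 < (continuants l).1 := by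
  cases l with
  | nil => exact one_pos
  | cons x l => exact h.1

theorem SuffixPos.snd_nonneg {l : List ℤ} (h : SuffixPos l) : 0 ≤ (continuants l).2 := by
  cases l with
  | nil => exact le_rfl
  | cons x l => exact h.2.fst_pos.le

theorem SuffixPos.one_le {l : List ℤ} (h : SuffixPos l) : ∀ x ∈ l, 1 ≤ x := by
  induction l with
  | nil => simp
  | cons x l ih =>
    intro y hy
    rcases List.mem_cons.1 hy with rfl | hy
    · have h1 := h.1
      have h2 := h.2.fst_pos
      have h3 := h.2.snd_nonneg
      simp only [continuants] at h1
      by_contra! hlt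
      nlinarith
    · exact ih h.2 y hy

theorem snd_lt_fst_of_two_le {l : List ℤ} (h : ∀ x ∈ l, 2 ≤ x) :
    0 ≤ (continuants l).2 ∧ (continuants l).2 < (continuants l).1 := by
  induction l with
  | nil => simp [continuants]
  | cons x l ih =>
    have hx : 2 ≤ x := h x (by simp)
    obtain ⟨h1, h2⟩ := ih fun y hy => h y (by simp [hy])
    simp only [continuants]
    constructor <;> nlinarith

theorem suffixPos_of_two_le {l : List ℤ} (h : ∀ x ∈ l, 2 ≤ x) : SuffixPos l := by
  induction l with
  | nil => trivial
  | cons x l ih =>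
    have := snd_lt_fst_of_two_le h
    exact ⟨by lia, ih fun y hy => h y (by simp [hy])⟩

theorem eq_of_continuants_eq {l m : List ℤ} (hl : ∀ x ∈ l, 2 ≤ x) (hm : ∀ x ∈ m, 2 ≤ x)
    (h : continuants l = continuants m) : l = m := by
  induction l generalizing m with
  | nil =>
    cases m with
    | nil => rfl
    | cons y m =>
      have h2 := snd_lt_fst_of_two_le (l := m) fun z hz => hm z (by simp [hz])
      simp only [continuants, Prod.mk.injEq] at h
      lia
  | cons x l ih =>
    have h1 := snd_lt_fst_of_two_le (l := l) fun z hz => hl z (by simp [hz])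
    cases m with
    | nil =>
      simp only [continuants, Prod.mk.injEq] at h
      lia
    | cons y m =>
      have h2 := snd_lt_fst_of_two_le (l := m) fun z hz => hm z (by simp [hz])
      simp only [continuants, Prod.mk.injEq] at h
      obtain ⟨h3, h4⟩ := h
      have hxy : x = y := by
        rw [h4] at h3 h1
        rcases lt_trichotomy x y with hlt | heq | hlt
        · nlinarith
        · exact heq
        · nlinarith
      subst hxy
      rw [ih (fun z hz => hl z (by simp [hz])) (fun z hz => hm z (by simp [hz]))
        (Prod.ext h4 (by rw [h4] at h3; lia))]

theorem continuants_append_congr (u : List ℤ) {l m : List ℤ}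
    (h : continuants l = continuants m) : continuants (u ++ l) = continuants (u ++ m) := by
  induction u with
  | nil => exact h
  | cons x u ih => simp only [List.cons_append, continuants, ih]

theorem SuffixPos.append_congr (u : List ℤ) {l m : List ℤ}
    (h : continuants l = continuants m) (hlm : SuffixPos l → SuffixPos m)
    (hl : SuffixPos (u ++ l)) : SuffixPos (u ++ m) := by
  induction u with
  | nil => exact hlm hl
  | cons x u ih =>
    refine ⟨?_, ih hl.2⟩
    exact (continuants_append_congr (x :: u) h ▸ hl.1 :)

theorem continuants_blowDown (a b : ℤ) (l : List ℤ) :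
    continuants (a :: 1 :: b :: l) = continuants ((a - 1) :: (b - 1) :: l) := by
  simp only [continuants, Prod.mk.injEq]
  constructor <;> ring

theorem continuants_blowDown_last (b : ℤ) : continuants [b, 1] = continuants [b - 1] := by
  simp [continuants]

theorem suffixPos_blowDown {a b : ℤ} {l : List ℤ} (h : SuffixPos (a :: 1 :: b :: l)) :
    SuffixPos ((a - 1) :: (b - 1) :: l) := by
  obtain ⟨h1, h2, -, h4⟩ := h
  rw [continuants_blowDown] at h1
  refine ⟨h1, ?_, h4⟩
  simp only [continuants] at h2 ⊢
  linarith

theorem suffixPos_blowDown_last {b : ℤ} (h : SuffixPos [b, 1]) : SuffixPos [b - 1] := by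
  have := h.1
  rw [continuants_blowDown_last] at this
  exact ⟨this, trivial⟩

theorem Ulist_append (l m : List ℤ) : Ulist (l ++ m) = Ulist l + Ulist m := by
  simp [Ulist]

theorem Ulist_le_of_continuants {c l : List ℤ} (hc : ∀ x ∈ c, 2 ≤ x) (hl : SuffixPos l)
    (h1 : 1 < (continuants l).1) (hcl : (continuants c).1 = (continuants l).1)
    (hdvd : (continuants l).1 ∣ (continuants l).2 - (continuants c).2) :
    Ulist c ≤ Ulist l := by
  induction hk : l.length generalizing l with
  | zero =>
    obtain rfl := List.length_eq_zero_iff.1 hk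
    simp [continuants] at h1
  | succ k ih =>
    by_cases htwo : ∀ x ∈ l, 2 ≤ x
    · have h2 := snd_lt_fst_of_two_le htwo
      have h3 := snd_lt_fst_of_two_le hc
      have h4 : (continuants l).2 - (continuants c).2 = 0 :=
        Int.eq_zero_of_abs_lt_dvd hdvd (abs_lt.2 ⟨by lia, by lia⟩)
      rw [eq_of_continuants_eq hc htwo (Prod.ext hcl (by lia))]
    · push Not at htwo
      obtain ⟨x, hx, hx2⟩ := htwo
      obtain rfl : x = 1 := by have := hl.one_le x hx; lia
      obtain ⟨s, t, rfl⟩ := List.append_of_mem hx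
      rcases List.eq_nil_or_concat s with rfl | ⟨s, a, rfl⟩
      · cases t with
        | nil => simp [continuants] at h1
        | cons b t =>
          have hK : (continuants ((b - 1) :: t)).1 = (continuants ([] ++ 1 :: b :: t)).1 := by
            simp only [continuants, List.nil_append]; ring
          have hK2 : (continuants ((b - 1) :: t)).2
              = (continuants ([] ++ 1 :: b :: t)).2 - (continuants ([] ++ 1 :: b :: t)).1 := by
            simp only [continuants, List.nil_append]; ring
          have := ih (l := (b - 1) :: t) ⟨hK ▸ hl.1, hl.2.2⟩ (hK ▸ h1) (hK ▸ hcl)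
            (by
              rw [hK, hK2, sub_right_comm]
              exact dvd_sub_self_right.2 hdvd)
            (by simpa using hk)
          simp only [List.nil_append, Ulist_cons] at this ⊢
          lia
      · cases t with
        | nil =>
          simp only [List.concat_eq_append, List.append_assoc, List.cons_append,
            List.nil_append] at *
          have hK := continuants_append_congr s (continuants_blowDown_last a)
          have := ih (hl.append_congr s (continuants_blowDown_last a) suffixPos_blowDown_last)
            (hK ▸ h1) (hK ▸ hcl) (hK ▸ hdvd) (by simpa using hk)
          simp only [Ulist_append, Ulist_cons] at this ⊢
          lia
        | cons b t =>
          simp only [List.concat_eq_append, List.append_assoc, List.cons_append,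
            List.nil_append] at *
          have hK := continuants_append_congr s (continuants_blowDown a b t)
          have := ih (hl.append_congr s (continuants_blowDown a b t) suffixPos_blowDown)
            (hK ▸ h1) (hK ▸ hcl) (hK ▸ hdvd)
            (by simp only [List.length_append, List.length_cons] at hk ⊢; lia)
          simp only [Ulist_append, Ulist_cons] at this ⊢
          lia

theorem Ulist_lt_of_interior_lt_two {c s t : List ℤ} {a x b : ℤ} (hc : ∀ y ∈ c, 2 ≤ y)
    (hl : SuffixPos (s ++ a :: x :: b :: t)) (hx : x < 2)
    (h1 : 1 < (continuants (s ++ a :: x :: b :: t)).1)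
    (hcl : (continuants c).1 = (continuants (s ++ a :: x :: b :: t)).1)
    (hdvd : (continuants (s ++ a :: x :: b :: t)).1 ∣
      (continuants (s ++ a :: x :: b :: t)).2 - (continuants c).2) :
    Ulist c < Ulist (s ++ a :: x :: b :: t) := by
  obtain rfl : x = 1 := by have := hl.one_le x (by simp); lia
  have hK := continuants_append_congr s (continuants_blowDown a b t)
  have := Ulist_le_of_continuants hc
    (hl.append_congr s (continuants_blowDown a b t) suffixPos_blowDown)
    (hK ▸ h1) (hK ▸ hcl) (hK ▸ hdvd)
  simp only [Ulist_append, Ulist_cons] at this ⊢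
  lia

theorem SuffixPos.snd_pos {l : List ℤ} (h : SuffixPos l) (hne : l ≠ []) :
    0 < (continuants l).2 := by
  cases l with
  | nil => exact absurd rfl hne
  | cons x l => exact h.2.fst_pos

theorem hj_cons_eq_continuants {x : ℤ} {l : List ℤ} (h : SuffixPos l) :
    hj ((x :: l).map Int.cast) = ((continuants (x :: l)).1 : ℝ) / (continuants (x :: l)).2 := by
  induction l generalizing x with
  | nil => simp [hj, continuants]
  | cons y l ih =>
    have h1 : ((continuants (y :: l)).1 : ℝ) ≠ 0 := by exact_mod_cast h.1.ne'
    have h2 := ih (x := y) h.2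
    simp only [List.map_cons] at h2 ⊢
    rw [hj, h2, one_div_div]
    simp only [continuants] at h1 ⊢
    push_cast at h1 ⊢
    rw [sub_div, mul_div_cancel_right₀ _ h1]

theorem eq_continuants_of_hj_eq {l : List ℤ} (h : SuffixPos l) (hne : l ≠ []) {p q : ℤ}
    (hp : 0 < p) (hq : 0 < q) (hpq : IsCoprime p q)
    (hval : hj (l.map Int.cast) = (p : ℝ) / q) :
    (continuants l).1 = p ∧ (continuants l).2 = q := by
  have h2 := h.snd_pos hne
  have h1 := h.fst_pos
  have hco := isCoprime_continuants l
  have hcross : (continuants l).1 * q = p * (continuants l).2 := by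
    cases l with
    | nil => exact absurd rfl hne
    | cons x l =>
      rw [hj_cons_eq_continuants h.2, div_eq_div_iff (by exact_mod_cast h2.ne')
        (by exact_mod_cast hq.ne')] at hval
      exact_mod_cast hval
  have hfst : (continuants l).1 = p := Int.dvd_antisymm h1.le hp.le
    (hco.dvd_of_dvd_mul_right ⟨q, hcross.symm⟩)
    (hpq.dvd_of_dvd_mul_right ⟨(continuants l).2, hcross⟩)
  rw [hfst] at hcross
  exact ⟨hfst, (mul_left_cancel₀ hp.ne' hcross).symm⟩

theorem MmatR_cons_submatrix (x : ℤ) (l : List ℤ) :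
    (MmatR (x :: l)).submatrix Fin.succ Fin.succ = MmatR l := by
  ext i j
  simp [MmatR]

theorem exists_MmatR_mulVec_eq {l : List ℤ} (h : hjDef (l.map Int.cast)) :
    ∃ v : Fin l.length → ℝ, (∀ i : Fin l.length, (i : ℕ) = 0 → v i = 1) ∧
      ∀ i : Fin l.length, (MmatR l).mulVec v i = if (i : ℕ) = 0 then hj (l.map Int.cast) else 0 := by
  induction l with
  | nil => exact h.elim
  | cons x l ih =>
    cases l with
    | nil =>
      refine ⟨fun _ => 1, fun _ _ => rfl, fun i => ?_⟩
      obtain rfl : i = (0 : Fin 1) := Fin.eq_zero (i : Fin 1)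
      simp [MmatR, Matrix.mulVec, dotProduct, hj]
    | cons y l =>
      obtain ⟨hd, hr⟩ := h
      obtain ⟨w, hw, hMw⟩ := ih hd
      set r := hj ((y :: l).map Int.cast)
      refine ⟨Fin.cons 1 fun i => w i / r, ?_, ?_⟩
      · intro i
        exact Fin.cases (fun _ => rfl) (fun j hj => absurd hj j.val.succ_ne_zero) i
      · intro i
        refine Fin.cases ?_ (fun j => ?_) i
        · have h0 := hw (0 : Fin (l.length + 1)) rfl
          have hx : hj ((x :: y :: l).map Int.cast) = x - 1 / r := rfl
          have hsum : ∑ i : Fin (l.length + 1),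
              MmatR (x :: y :: l) (0 : Fin (l.length + 2)) i.succ * (w i / r) = -(1 / r) := by
            rw [Fin.sum_univ_succ, h0]
            simp [MmatR]
          rw [hx, Matrix.mulVec, dotProduct]
          refine (Fin.sum_univ_succ _).trans ((congrArg₂ (· + ·) rfl hsum).trans ?_)
          simp [MmatR, sub_eq_add_neg]
        · have hj := hMw j
          rw [Matrix.mulVec, dotProduct] at hj ⊢
          refine (Fin.sum_univ_succ _).trans ?_
          have hsum : ∑ i : Fin (y :: l).length, MmatR (x :: y :: l) j.succ i.succ *
              (Fin.cons 1 (fun i => w i / r) : Fin (x :: y :: l).length → ℝ) i.succ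
              = (∑ i, MmatR (y :: l) j i * w i) / r := by
            rw [Finset.sum_div]
            refine Finset.sum_congr rfl fun i _ => ?_
            rw [← MmatR_cons_submatrix x (y :: l), Matrix.submatrix_apply, Fin.cons_succ,
              mul_div_assoc]
          refine (congrArg₂ (· + ·) rfl (hsum.trans (congrArg (· / r) hj))).trans ?_
          by_cases hj0 : (j : ℕ) = 0
          · simp [MmatR, hj0, div_self (show r ≠ 0 from hr)]
          · simp [MmatR, hj0]

theorem hj_nonneg_of_posSemidef {l : List ℤ} (h : hjDef (l.map Int.cast))
    (hM : (MmatR l).PosSemidef) : 0 ≤ hj (l.map Int.cast) := by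
  obtain ⟨v, hv, hMv⟩ := exists_MmatR_mulVec_eq h
  have hpos := hM.dotProduct_mulVec_nonneg v
  cases l with
  | nil => exact h.elim
  | cons x l =>
    rw [dotProduct] at hpos
    replace hpos := hpos.trans_eq (Fin.sum_univ_succ _)
    have h0 := hv (0 : Fin (l.length + 1)) rfl
    simpa [hMv, show v 0 = 1 from h0] using hpos

theorem suffixPos_of_posSemidef {l : List ℤ} (h : hjDef (l.map Int.cast))
    (hM : (MmatR l).PosSemidef) (hpos : 0 < hj (l.map Int.cast)) : SuffixPos l := by
  induction l with
  | nil => trivial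
  | cons x l ih =>
    have htail : SuffixPos l := by
      cases l with
      | nil => trivial
      | cons y l =>
        have hM' := hM.submatrix Fin.succ
        rw [MmatR_cons_submatrix] at hM'
        exact ih h.1 hM' ((hj_nonneg_of_posSemidef (l := y :: l) h.1 hM').lt_of_ne' h.2)
    refine ⟨?_, htail⟩
    have h2 : (0 : ℝ) < (continuants (x :: l)).2 := by exact_mod_cast htail.fst_pos
    rw [hj_cons_eq_continuants htail, div_pos_iff_of_pos_right h2] at hpos
    exact_mod_cast hpos

theorem Ulist_seg_one (a : ℕ → ℤ) (k : ℕ) :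
    Ulist (seg a 1 k) = ∑ i ∈ Finset.Icc 1 k, (a i - 2) := by
  induction k with
  | zero => simp [Ulist, seg]
  | succ k ih =>
    have hseg : seg a 1 (k + 1) = seg a 1 k ++ [a (k + 1)] := by
      simp [seg, List.range_succ, add_comm]
    rw [hseg, Ulist_append, ih, Finset.sum_Icc_succ_top (by lia)]
    simp [Ulist]

theorem exists_seg_one_eq_append (a : ℕ → ℤ) {k i : ℕ} (h1 : 1 < i) (hk : i < k) :
    ∃ s t, seg a 1 k = s ++ a (i - 1) :: a i :: a (i + 1) :: t := by
  obtain ⟨i, rfl⟩ := Nat.exists_eq_add_of_le' h1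
  obtain ⟨m, rfl⟩ := Nat.exists_eq_add_of_lt hk
  refine ⟨(List.range i).map fun t => a (1 + t),
    (List.range m).map fun t => a (i + 4 + t), ?_⟩
  rw [seg, show i + 2 + m + 1 + 1 - 1 = i + (m + 3) by lia, List.range_add]
  simp only [List.range_succ_eq_map (n := m + 2), List.range_succ_eq_map (n := m + 1),
    List.range_succ_eq_map (n := m), List.map_append, List.map_cons, List.map_map]
  have h1 : 1 + (i + 0) = i + 2 - 1 := by lia
  have h2 : 1 + (i + Nat.succ 0) = i + 2 := by lia
  have h3 : 1 + (i + Nat.succ (Nat.succ 0)) = i + 2 + 1 := by lia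
  rw [h1, h2, h3]
  congr 4
  refine List.map_congr_left fun t _ => congrArg a ?_
  simp only [Function.comp_apply]
  lia

/-- Let `n = (n_1,…,n_k)` be an admissible tuple of non-negative integers whose
Hirzebruch–Jung continued fraction is defined and equals `α/β` with `α > 1`,
`β > 0` coprime. Let `β*` be the unique integer with `1 ≤ β* < α` and
`β* ≡ β (mod α)`. Then `Σ (n_i − 2) ≥ U(α/β*)`; moreover, equality implies
`n_i ≥ 2` for all `1 < i < k`. -/
theorem stmt_15 (n : ℕ → ℤ) (k : ℕ) (hk : 1 ≤ k)
    (hnn : ∀ i, 1 ≤ i → i ≤ k → 0 ≤ n i) (hadm : Admissible (seg n 1 k))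
    (hdef : hjDef (segR n 1 k)) (α β : ℤ) (hα : 1 < α) (hβ : 0 < β)
    (hco : IsCoprime α β) (hval : hj (segR n 1 k) = (α : ℝ) / (β : ℝ))
    (βs : ℤ) (hβs1 : 1 ≤ βs) (hβs2 : βs < α) (hβsm : α ∣ β - βs)
    (c : List ℤ) (hc : IsHJExp c α βs) :
    Ulist c ≤ ∑ i ∈ Finset.Icc 1 k, (n i - 2) ∧
      (Ulist c = ∑ i ∈ Finset.Icc 1 k, (n i - 2) →
        ∀ i, 1 < i → i < k → 2 ≤ n i) := by
  have hne : seg n 1 k ≠ [] := by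
    rw [← List.length_pos_iff, length_seg_one]
    exact hk
  have hl : SuffixPos (seg n 1 k) := by
    refine suffixPos_of_posSemidef hdef hadm.1 ?_
    rw [← segR, hval]
    have : (0 : ℝ) < α := by exact_mod_cast one_pos.trans hα
    have : (0 : ℝ) < β := by exact_mod_cast hβ
    positivity
  obtain ⟨e1, e2⟩ := eq_continuants_of_hj_eq hl hne (by lia) hβ hco hval
  obtain ⟨hcne, hc2, hcval⟩ := hc
  have hcos : IsCoprime α βs := by
    obtain ⟨d, hd⟩ := hβsm
    obtain ⟨u, v, huv⟩ := hco
    exact ⟨u + v * d, v, by linear_combination huv - v * hd⟩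
  obtain ⟨f1, f2⟩ := eq_continuants_of_hj_eq (suffixPos_of_two_le hc2) hcne (by lia) (by lia)
    hcos hcval
  rw [← e1] at hα f1
  rw [← e1, ← e2, ← f2] at hβsm
  rw [← Ulist_seg_one]
  refine ⟨Ulist_le_of_continuants hc2 hl hα f1 hβsm, fun heq i hi hik => ?_⟩
  by_contra! hlt
  obtain ⟨s, t, hst⟩ := exists_seg_one_eq_append n hi hik
  rw [hst] at hl hα f1 hβsm heq
  exact (Ulist_lt_of_interior_lt_two hc2 hl hlt hα f1 hβsm).ne heq
end

section
/- Let n = (n_1,…,n_k) be an admissible tuple such that the Hirzebruch–Jung continued fraction [n_1,…,n_k]⁻ is defined and equals 0, and let p_i, q_i denote the convergents of (n_1,…,n_k). Then for every i with 1 < i ≤ k, the continued fraction [n_i,…,n_k]⁻ is defined and equals p_{i−2}/p_{i−1}. -/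
/-- Numerators of the convergents: `p_0 = 1`, `p_1 = a_1`,
`p_k = a_k p_{k−1} − p_{k−2}` for `k ≥ 2`. -/
def convP (a : ℕ → ℤ) : ℕ → ℤ
  | 0 => 1
  | 1 => a 1
  | k + 2 => a (k + 2) * convP a (k + 1) - convP a k

/-- Denominators of the convergents: `q_0 = 0`, `q_1 = 1`,
`q_k = a_k q_{k−1} − q_{k−2}` for `k ≥ 2`. -/
def convQ (a : ℕ → ℤ) : ℕ → ℤ
  | 0 => 0
  | 1 => 1
  | k + 2 => a (k + 2) * convQ a (k + 1) - convQ a k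

theorem segR_eq_cons (a : ℕ → ℤ) {i j : ℕ} (h : i ≤ j) :
    segR a i j = (a i : ℝ) :: segR a (i + 1) j := by
  have hlen : j + 1 - i = (j + 1 - (i + 1)) + 1 := by omega
  simp [segR, seg, hlen, List.range_succ_eq_map, Function.comp_def, Nat.add_comm,
    Nat.add_left_comm]

theorem hjDef_segR_iff (a : ℕ → ℤ) {i j : ℕ} (h : i < j) :
    hjDef (segR a i j) ↔ hjDef (segR a (i + 1) j) ∧ hj (segR a (i + 1) j) ≠ 0 := by
  rw [segR_eq_cons a h.le, segR_eq_cons a (Nat.succ_le_of_lt h)]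
  rfl

theorem hj_segR (a : ℕ → ℤ) {i j : ℕ} (h : i < j) :
    hj (segR a i j) = a i - 1 / hj (segR a (i + 1) j) := by
  rw [segR_eq_cons a h.le, segR_eq_cons a (Nat.succ_le_of_lt h)]
  rfl

/-- If `[a_1, …, a_k]⁻` is defined and vanishes, then each proper tail is defined, nonzero, and
given by a quotient of consecutive convergent numerators. -/
theorem hj_segR_tail (a : ℕ → ℤ) {k : ℕ} (hdef : hjDef (segR a 1 k))
    (hval : hj (segR a 1 k) = 0) (m : ℕ) (hm : m + 2 ≤ k) :
    hjDef (segR a (m + 2) k) ∧ hj (segR a (m + 2) k) ≠ 0 ∧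
      hj (segR a (m + 2) k) = (convP a m : ℝ) / (convP a (m + 1) : ℝ) := by
  induction m with
  | zero =>
    obtain ⟨hd, hne⟩ := (hjDef_segR_iff a (by omega : 1 < k)).1 hdef
    refine ⟨hd, hne, ?_⟩
    have hrec := hj_segR a (by omega : 1 < k)
    rw [hval] at hrec
    have hinv : (a 1 : ℝ) = 1 / hj (segR a (1 + 1) k) := by linarith
    simp [convP, hinv]
  | succ m ih =>
    obtain ⟨hd, hne, heq⟩ := ih (by omega)
    obtain ⟨hd', hne'⟩ := (hjDef_segR_iff a (by omega : m + 2 < k)).1 hd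
    refine ⟨hd', hne', ?_⟩
    have hrec := hj_segR a (by omega : m + 2 < k)
    have hp : (convP a (m + 1) : ℝ) ≠ 0 := fun h0 => hne (by rw [heq, h0, div_zero])
    have hinv : (convP a (m + 2) : ℝ) / convP a (m + 1) = 1 / hj (segR a (m + 2 + 1) k) := by
      have hrec' : 1 / hj (segR a (m + 2 + 1) k) =
          a (m + 2) - (convP a m : ℝ) / convP a (m + 1) := by linarith
      rw [hrec', convP]
      push_cast
      field_simp
    change hj (segR a (m + 2 + 1) k) = (convP a (m + 1) : ℝ) / convP a (m + 2)
    rw [← inv_div, hinv, one_div, inv_inv]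

/-- Let `n = (n_1,…,n_k)` be an admissible tuple of non-negative integers with
`[n_1,…,n_k]⁻` defined and equal to `0`. Then for `1 < i ≤ k`, the continued
fraction `[n_i,…,n_k]⁻` is defined and equals `p_{i−2}/p_{i−1}`. -/
theorem stmt_16 (n : ℕ → ℤ) (k : ℕ) (hk : 1 ≤ k)
    (hnn : ∀ i, 1 ≤ i → i ≤ k → 0 ≤ n i) (hadm : Admissible (seg n 1 k))
    (hdef : hjDef (segR n 1 k)) (hval : hj (segR n 1 k) = 0) :
    ∀ i, 1 < i → i ≤ k → hjDef (segR n i k) ∧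
      hj (segR n i k) = (convP n (i - 2) : ℝ) / (convP n (i - 1) : ℝ) := by
  intro i hi hik
  obtain ⟨m, rfl⟩ : ∃ m, i = m + 2 := ⟨i - 2, by omega⟩
  obtain ⟨hd, -, heq⟩ := hj_segR_tail n hdef hval m hik
  exact ⟨hd, heq⟩
end

section
/- Let n = (n_1,…,n_k) be an admissible tuple such that the Hirzebruch–Jung continued fraction [n_1,…,n_k]⁻ is defined and equals 0. Then for every i with 1 < i < k, one has det M(n_1,…,n_{i−1}) = det M(n_{i+1},…,n_k). -/
/-- The tridiagonal matrix `M(x)` with diagonal entries `x_1, …, x_k` and all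
sub- and super-diagonal entries equal to `−1` (all other entries `0`). -/
def Mmat (l : List ℤ) : Matrix (Fin l.length) (Fin l.length) ℤ :=
  Matrix.of fun i j =>
    if (i : ℕ) = (j : ℕ) then l.get i
    else if (i : ℕ) + 1 = (j : ℕ) ∨ (j : ℕ) + 1 = (i : ℕ) then -1 else 0

/-- The continuant of a list, computed by the three-term recursion satisfied by the
determinants of the matrices `Mmat`. -/
def continuant : List ℤ → ℤ
  | [] => 1
  | [x] => x
  | x :: y :: l => x * continuant (y :: l) - continuant l

theorem continuant_append_pair (l : List ℤ) (a b : ℤ) :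
    continuant (l ++ [a, b]) = b * continuant (l ++ [a]) - continuant l := by
  induction l using continuant.induct with
  | case1 => simp [continuant]; ring
  | case2 x => simp [continuant]; ring
  | case3 x y l ih₁ ih₂ =>
    simp only [List.cons_append, continuant] at ih₁ ih₂ ⊢
    rw [ih₁, ih₂]
    ring

theorem Mmat_cons_submatrix_succ (x : ℤ) (l : List ℤ) :
    (Mmat (x :: l)).submatrix (Fin.succ : Fin l.length → Fin (l.length + 1)) Fin.succ
      = Mmat l := by
  ext i j
  simp [Mmat]

/-- Expansion of a determinant whose first row and column vanish beyond the second entry. -/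
theorem det_eq_sub_of_first_row_col {R : Type*} [CommRing R] {m : ℕ}
    (A : Matrix (Fin (m + 2)) (Fin (m + 2)) R)
    (hrow : ∀ j : Fin m, A 0 j.succ.succ = 0) (hcol : ∀ i : Fin m, A i.succ.succ 0 = 0) :
    A.det = A 0 0 * (A.submatrix Fin.succ Fin.succ).det
      - A 0 1 * A 1 0 *
        ((A.submatrix Fin.succ Fin.succ).submatrix Fin.succ Fin.succ).det := by
  have minor : (A.submatrix Fin.succ (Fin.succAbove 1)).det
      = A 1 0 * ((A.submatrix Fin.succ Fin.succ).submatrix Fin.succ Fin.succ).det := by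
    have h : (A.submatrix Fin.succ (Fin.succAbove 1)).submatrix Fin.succ Fin.succ
        = (A.submatrix Fin.succ Fin.succ).submatrix Fin.succ Fin.succ := by
      ext i j
      have hj : Fin.succAbove (1 : Fin (m + 2)) j.succ = j.succ.succ :=
        Fin.succAbove_of_lt_succ _ _ (by simp [Fin.lt_def])
      simp only [Matrix.submatrix_apply, hj]
    rw [Matrix.det_succ_column_zero, Fin.sum_univ_succ, Finset.sum_eq_zero]
    · rw [Fin.succAbove_zero, h]
      simp
    · intro i _
      simp [hcol]
  rw [Matrix.det_succ_row_zero, Fin.sum_univ_succ, Fin.succAbove_zero, Fin.sum_univ_succ,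
    Finset.sum_eq_zero, Fin.succ_zero_eq_one, minor]
  · simp
    ring
  · intro i _
    simp [hrow]

theorem det_Mmat_cons_cons (x y : ℤ) (l : List ℤ) :
    (Mmat (x :: y :: l)).det = x * (Mmat (y :: l)).det - (Mmat l).det := by
  have h := det_eq_sub_of_first_row_col (m := l.length) (Mmat (x :: y :: l))
    (fun j => by simp [Mmat]) (fun i => by simp [Mmat])
  have h₁ : (Mmat (x :: y :: l)).submatrix
      (Fin.succ : Fin (l.length + 1) → Fin (l.length + 2)) Fin.succ = Mmat (y :: l) :=
    Mmat_cons_submatrix_succ x (y :: l)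
  have h₂ := Mmat_cons_submatrix_succ y l
  rw [h₁, h₂] at h
  refine h.trans ?_
  simp [Mmat]

theorem det_Mmat (l : List ℤ) : (Mmat l).det = continuant l := by
  induction l using continuant.induct with
  | case1 => exact Matrix.det_fin_zero
  | case2 x =>
    change Matrix.det (n := Fin 1) (Mmat [x]) = x
    rw [Matrix.det_fin_one]
    simp [Mmat]
  | case3 x y l ih₁ ih₂ => rw [det_Mmat_cons_cons, ih₁, ih₂, continuant]

theorem hj_eq_continuant_div (l : List ℤ) (h : hjDef (l.map Int.cast)) :
    continuant l.tail ≠ 0 ∧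
      hj (l.map Int.cast) = (continuant l : ℝ) / continuant l.tail := by
  induction l with
  | nil => exact h.elim
  | cons x l ih =>
    cases l with
    | nil => simp [hj, continuant]
    | cons y l =>
      obtain ⟨hd, hne⟩ := h
      obtain ⟨h₀, he⟩ := ih hd
      have he' : hj ((y : ℝ) :: l.map Int.cast)
          = (continuant (y :: l) : ℝ) / continuant l := he
      rw [he'] at hne
      have hr : (continuant (y :: l) : ℝ) ≠ 0 := fun hz => hne (by simp [hz])
      have hr₀ : (continuant l : ℝ) ≠ 0 := by exact_mod_cast h₀
      refine ⟨by exact_mod_cast hr, ?_⟩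
      simp only [List.map_cons, hj, he', continuant, List.tail_cons]
      push_cast
      field_simp

theorem map_Mmat (l : List ℤ) : (Mmat l).map (Int.cast : ℤ → ℝ) = MmatR l := by
  ext i j
  simp only [Mmat, MmatR, Matrix.map_apply, Matrix.of_apply]
  split_ifs <;> simp

theorem MmatR_cons_submatrix_succ (x : ℤ) (l : List ℤ) :
    (MmatR (x :: l)).submatrix (Fin.succ : Fin l.length → Fin (l.length + 1)) Fin.succ
      = MmatR l := by
  ext i j
  simp [MmatR]

theorem continuant_tail_nonneg (x : ℤ) (l : List ℤ) (h : (MmatR (x :: l)).PosSemidef) :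
    0 ≤ continuant l := by
  have h' := h.submatrix (Fin.succ : Fin l.length → Fin (l.length + 1))
  have h₁ : (MmatR l).PosSemidef := by
    rw [← MmatR_cons_submatrix_succ x l]; exact h'
  have h₂ := h₁.det_nonneg
  rw [← map_Mmat, ← Int.cast_det, det_Mmat] at h₂
  exact_mod_cast h₂

theorem seg_eq_cons (a : ℕ → ℤ) {i j : ℕ} (h : i ≤ j) :
    seg a i j = a i :: seg a (i + 1) j := by
  have e : j + 1 - i = (j + 1 - (i + 1)) + 1 := by omega
  simp only [seg, e, List.range_succ_eq_map, List.map_cons, List.map_map, add_zero]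
  congr 2
  funext t
  simp only [Function.comp_apply]
  congr 1
  omega

theorem seg_succ_eq_append (a : ℕ → ℤ) {i j : ℕ} (h : i ≤ j + 1) :
    seg a i (j + 1) = seg a i j ++ [a (j + 1)] := by
  have e : j + 1 + 1 - i = (j + 1 - i) + 1 := by omega
  have e' : i + (j + 1 - i) = j + 1 := by omega
  simp [seg, e, List.range_succ, e']

theorem seg_succ_self (a : ℕ → ℤ) (k : ℕ) : seg a (k + 1) k = [] := by
  simp [seg]

theorem continuant_seg_left (a : ℕ → ℤ) {i k : ℕ} (h : i < k) :
    continuant (seg a i k)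
      = a i * continuant (seg a (i + 1) k) - continuant (seg a (i + 2) k) := by
  rw [seg_eq_cons a h.le, seg_eq_cons a (i := i + 1) h, continuant]

theorem continuant_seg_right (a : ℕ → ℤ) (j : ℕ) :
    continuant (seg a 1 (j + 2))
      = a (j + 2) * continuant (seg a 1 (j + 1)) - continuant (seg a 1 j) := by
  rw [seg_succ_eq_append a (by omega), seg_succ_eq_append a (by omega), List.append_assoc]
  exact continuant_append_pair _ _ _

/-- If the full continuant vanishes, the right continuants are proportional to the
left ones. -/
theorem continuant_seg_proportional (a : ℕ → ℤ) (k : ℕ)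
    (h₀ : continuant (seg a 1 k) = 0) (j : ℕ) (hj : j < k) :
    continuant (seg a (j + 2) k)
      = continuant (seg a 2 k) * continuant (seg a 1 j) := by
  induction j using Nat.twoStepInduction with
  | zero => simp [seg_succ_self, continuant]
  | one =>
    have h := continuant_seg_left a hj
    have h₁ : continuant (seg a 1 1) = a 1 := by simp [seg, continuant]
    rw [h₁]
    linarith
  | more j ih₁ ih₂ =>
    have h := continuant_seg_left a hj
    rw [continuant_seg_right]
    have e₁ := ih₁ (by omega)
    have e₂ := ih₂ (by omega)
    linear_combination h - e₁ + a (j + 2) * e₂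

/-- Let `n = (n_1,…,n_k)` be an admissible tuple of non-negative integers with
`[n_1,…,n_k]⁻` defined and equal to `0`. Then for every `1 < i < k`,
`det M(n_1,…,n_{i−1}) = det M(n_{i+1},…,n_k)`. -/
theorem stmt_17 (n : ℕ → ℤ) (k : ℕ) (hk : 1 ≤ k)
    (hnn : ∀ i, 1 ≤ i → i ≤ k → 0 ≤ n i) (hadm : Admissible (seg n 1 k))
    (hdef : hjDef (segR n 1 k)) (hval : hj (segR n 1 k) = 0) :
    ∀ i, 1 < i → i < k →
      (Mmat (seg n 1 (i - 1))).det = (Mmat (seg n (i + 1) k)).det := by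
  have h₀ : continuant (seg n 1 k) = 0 := by
    obtain ⟨hne, he⟩ := hj_eq_continuant_div (seg n 1 k) hdef
    have hz : (continuant (seg n 1 k) : ℝ) / continuant (seg n 1 k).tail = 0 :=
      he.symm.trans hval
    rcases div_eq_zero_iff.mp hz with h | h
    · exact_mod_cast h
    · exact absurd (by exact_mod_cast h) hne
  have hpos : 0 ≤ continuant (seg n 2 k) := by
    have h := hadm.1
    rw [seg_eq_cons n hk] at h
    exact continuant_tail_nonneg _ _ h
  have hunit : continuant (seg n 2 k) = 1 := by
    have h := continuant_seg_proportional n k h₀ (k - 1) (by omega)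
    have e : k - 1 + 2 = k + 1 := by omega
    rw [e, seg_succ_self] at h
    exact Int.eq_one_of_mul_eq_one_right hpos h.symm
  intro i hi hik
  have h := continuant_seg_proportional n k h₀ (i - 1) (by omega)
  have e : i - 1 + 2 = i + 1 := by omega
  rw [e, hunit, one_mul] at h
  rw [det_Mmat, det_Mmat, h]
end
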